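/- Let f be the binomial of Family (2) on L = GF(2^{4k}), n = 4k. Then the nonlinearity of f satisfies NL(f) ≥ 2^{n−1} − 2^{n/2}; equivalently, |f^W(a,b)| ≤ 2^{(n+2)/2} for all a ∈ L and b ∈ L*. -/

import Mathlib

/-- The square of a sum of signs of a quadratic form over `𝔽₂` is at most the size of the space
times the size of the radical of the polar form. -/
theorem sq_sum_sign_le {V : Type*} [AddCommGroup V] [Fintype V] (g : V → ZMod 2)
    (B : V → V → ZMod 2) (hB : ∀ x u, g (x + u) = g x + g u + B x u)
    (hadd : ∀ x y u, B (x + y) u = B x u + B y u) (N : ℕ)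
    (hN : ∀ K : Finset V, (∀ u ∈ K, ∀ x, B x u = 0) → K.card ≤ N) :
    (∑ x : V, (-1 : ℤ) ^ (g x).val) ^ 2 ≤ Fintype.card V * N := by
  classical
  have hmul : ∀ p q : ZMod 2, (-1 : ℤ) ^ (p + q).val = (-1) ^ p.val * (-1) ^ q.val := by decide
  have hsq : ∀ p : ZMod 2, (-1 : ℤ) ^ p.val * (-1) ^ p.val = 1 := by decide
  have hle : ∀ p : ZMod 2, (-1 : ℤ) ^ p.val ≤ 1 := by decide
  have h_ne : ∀ p : ZMod 2, p ≠ 0 → (-1 : ℤ) ^ p.val = -1 := by decide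
  have expand : (∑ x : V, (-1 : ℤ) ^ (g x).val) ^ 2 =
      ∑ u : V, (-1 : ℤ) ^ (g u).val * ∑ x : V, (-1 : ℤ) ^ (B x u).val := by
    rw [sq, Finset.sum_mul_sum]
    have : ∀ x : V, ∑ y : V, (-1 : ℤ) ^ (g x).val * (-1 : ℤ) ^ (g y).val =
        ∑ u : V, (-1 : ℤ) ^ (g u).val * (-1 : ℤ) ^ (B x u).val := by
      intro x
      rw [← Equiv.sum_comp (Equiv.addLeft x)]
      refine Finset.sum_congr rfl fun u _ => ?_
      simp only [Equiv.coe_addLeft, hB, hmul]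
      linear_combination ((-1 : ℤ) ^ (g u).val * (-1 : ℤ) ^ (B x u).val) * hsq (g x)
    simp_rw [this]
    rw [Finset.sum_comm]
    simp_rw [Finset.mul_sum]
  have inner : ∀ u : V, (-1 : ℤ) ^ (g u).val * ∑ x : V, (-1 : ℤ) ^ (B x u).val ≤
      if ∀ x, B x u = 0 then (Fintype.card V : ℤ) else 0 := by
    intro u
    split_ifs with h
    · simp only [h, ZMod.val_zero, pow_zero, Finset.sum_const, Finset.card_univ, nsmul_eq_mul,
        mul_one]
      exact mul_le_of_le_one_left (by positivity) (hle _)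
    · push Not at h
      obtain ⟨y, hy⟩ := h
      have : ∑ x : V, (-1 : ℤ) ^ (B x u).val = - ∑ x : V, (-1 : ℤ) ^ (B x u).val := by
        conv_lhs => rw [← Equiv.sum_comp (Equiv.addLeft y)]
        simp [hadd, hmul, h_ne _ hy]
      have h0 : ∑ x : V, (-1 : ℤ) ^ (B x u).val = 0 := by linarith
      rw [h0, mul_zero]
  rw [expand]
  refine (Finset.sum_le_sum fun u _ => inner u).trans ?_
  rw [← Finset.sum_filter, Finset.sum_const, nsmul_eq_mul, mul_comm]
  gcongr
  exact hN _ fun u hu => (Finset.mem_filter.1 hu).2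

section Kernel

variable {L : Type*} [Field L] (σ : L →+* L)

/-- If the matrix of the semilinear system is singular, the system has only the zero solution. -/
theorem eq_zero_of_det_eq_zero {b b' A A' u u' : L}
    (hne : σ A' * b ≠ A * σ b) (hD : b * b' - A * A' = 0) (hu' : u' = 0 → u = 0)
    (h₁ : σ b * σ (σ u) + σ A * σ (σ u') = b * u + A' * u')
    (h₂ : σ A' * σ (σ u) + σ b' * σ (σ u') = A * u + b' * u') : u = 0 := by
  have hσD : σ b * σ b' - σ A * σ A' = 0 := by simpa using congrArg σ hD
  have hX : b * u + A' * u' = 0 := by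
    have : (σ A' * b - A * σ b) * (b * u + A' * u') = 0 := by
      linear_combination (-b * σ A') * h₁ + (b * σ b) * h₂ - (b * σ (σ u')) * hσD + σ b * u' * hD
    exact (mul_eq_zero.1 this).resolve_left (sub_ne_zero.2 hne)
  have hY : b * σ u + A * σ u' = 0 := by
    apply σ.injective
    rw [map_zero, ← hX, ← h₁]
    simp
  have hσX : σ b * σ u + σ A' * σ u' = 0 := by simpa using congrArg σ hX
  have : (σ A' * b - A * σ b) * σ u' = 0 := by
    linear_combination b * hσX - σ b * hY
  have := (mul_eq_zero.1 this).resolve_left (sub_ne_zero.2 hne)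
  exact hu' ((map_eq_zero σ).1 this)

/-- The determinant of two solutions of the semilinear system vanishes. -/
theorem wronskian_eq_zero {b b' A A' u u' v v' : L} (hD : b * b' - A * A' ≠ 0)
    (hfix : ∀ z, σ z = z → z ≠ 0 → z = 1)
    (hD1 : ∀ w, (b * b' - A * A') * (w * σ w) ≠ 1)
    (h₁ : σ b * σ (σ u) + σ A * σ (σ u') = b * u + A' * u')
    (h₂ : σ A' * σ (σ u) + σ b' * σ (σ u') = A * u + b' * u')
    (k₁ : σ b * σ (σ v) + σ A * σ (σ v') = b * v + A' * v')
    (k₂ : σ A' * σ (σ v) + σ b' * σ (σ v') = A * v + b' * v') : u * v' - v * u' = 0 := by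
  by_contra hW
  set D := b * b' - A * A' with hDdef
  set W := u * v' - v * u' with hWdef
  have key : σ D * σ (σ W) = D * W := by
    have e : σ D * σ (σ W) = (σ b * σ (σ u) + σ A * σ (σ u')) * (σ A' * σ (σ v) + σ b' * σ (σ v')) -
        (σ b * σ (σ v) + σ A * σ (σ v')) * (σ A' * σ (σ u) + σ b' * σ (σ u')) := by
      simp only [hDdef, hWdef, map_sub, map_mul]
      ring
    rw [e, h₁, h₂, k₁, k₂]
    ring
  refine hD1 W (hfix _ ?_ ?_)
  · simp only [map_mul]
    linear_combination σ W * key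
  · exact mul_ne_zero hD (mul_ne_zero hW ((map_ne_zero σ).2 hW))

/-- The ratio of two solutions with vanishing determinant is fixed by `σ²`. -/
theorem map_map_eq_of_ratio {b b' A A' u u' l : L} (hD : b * b' - A * A' ≠ 0) (hu : u ≠ 0)
    (h₁ : σ b * σ (σ u) + σ A * σ (σ u') = b * u + A' * u')
    (h₂ : σ A' * σ (σ u) + σ b' * σ (σ u') = A * u + b' * u')
    (k₁ : σ b * σ (σ (l * u)) + σ A * σ (σ (l * u')) = b * (l * u) + A' * (l * u'))
    (k₂ : σ A' * σ (σ (l * u)) + σ b' * σ (σ (l * u')) = A * (l * u) + b' * (l * u')) :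
    σ (σ l) = l := by
  simp only [map_mul] at k₁ k₂
  have e₁ : (σ (σ l) - l) * (b * u + A' * u') = 0 := by
    linear_combination k₁ - σ (σ l) * h₁
  have e₂ : (σ (σ l) - l) * (A * u + b' * u') = 0 := by
    linear_combination k₂ - σ (σ l) * h₂
  have e : (σ (σ l) - l) * ((b * b' - A * A') * u) = 0 := by
    linear_combination b' * e₁ - A' * e₂
  exact sub_eq_zero.1 ((mul_eq_zero.1 e).resolve_right (mul_ne_zero hD hu))

/-- The semilinear system has at most four solutions. -/
theorem card_le_four (c : L →+* L) {b A : L}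
    (hne : σ (c A) * b ≠ A * σ b)
    (hfix : ∀ z, σ z = z → z ≠ 0 → z = 1) (hfix2 : ∀ z, σ (σ z) = z → z ^ 4 = z)
    (hD1 : ∀ w, b * c b - A * c A ≠ 0 → (b * c b - A * c A) * (w * σ w) ≠ 1)
    (K : Finset L)
    (h₁ : ∀ u ∈ K, σ b * σ (σ u) + σ A * σ (σ (c u)) = b * u + c A * c u)
    (h₂ : ∀ u ∈ K, σ (c A) * σ (σ u) + σ (c b) * σ (σ (c u)) = A * u + c b * c u) :
    K.card ≤ 4 := by
  classical
  by_cases hK : ∀ u ∈ K, u = 0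
  · have : K ⊆ {0} := fun u hu => by simpa using hK u hu
    exact (Finset.card_le_card this).trans (by simp)
  push Not at hK
  obtain ⟨u, hu, hu0⟩ := hK
  have hD : b * c b - A * c A ≠ 0 := fun hD =>
    hu0 (eq_zero_of_det_eq_zero σ hne hD (fun h => (map_eq_zero c).1 h) (h₁ u hu) (h₂ u hu))
  have hp : (Polynomial.X ^ 4 - Polynomial.X : Polynomial L).natDegree = 4 := by compute_degree!
  have hp0 : (Polynomial.X ^ 4 - Polynomial.X : Polynomial L) ≠ 0 := by
    intro h
    rw [h] at hp
    simp at hp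
  have hsub : K.image (fun v => v / u) ⊆
      (Polynomial.X ^ 4 - Polynomial.X : Polynomial L).roots.toFinset := by
    intro l hl
    obtain ⟨v, hv, rfl⟩ := Finset.mem_image.1 hl
    have hW := wronskian_eq_zero σ hD hfix (fun w => hD1 w hD) (h₁ u hu) (h₂ u hu)
      (h₁ v hv) (h₂ v hv)
    have ev : v / u * u = v := div_mul_cancel₀ v hu0
    have ev' : v / u * c u = c v := by
      field_simp
      linear_combination -hW
    have := map_map_eq_of_ratio σ (l := v / u) hD hu0 (h₁ u hu) (h₂ u hu)
      (by rw [ev, ev']; exact h₁ v hv) (by rw [ev, ev']; exact h₂ v hv)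
    simp only [Multiset.mem_toFinset, Polynomial.mem_roots hp0, Polynomial.IsRoot,
      Polynomial.eval_sub, Polynomial.eval_pow, Polynomial.eval_X]
    exact sub_eq_zero.2 (hfix2 _ this)
  have hinj : Function.Injective fun v : L => v / u := fun v w h => (div_left_inj' hu0).1 h
  rw [← Finset.card_image_of_injective K hinj]
  calc _ ≤ _ := Finset.card_le_card hsub
    _ ≤ _ := Multiset.toFinset_card_le _
    _ ≤ _ := Polynomial.card_roots' _
    _ = 4 := hp

end Kernel

section Trace

variable {L : Type*} [Field L] [Fintype L] [Algebra (ZMod 2) L]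

/-- The absolute trace is invariant under iterates of the Frobenius. -/
theorem trace_pow_two_pow (j : ℕ) (x : L) :
    Algebra.trace (ZMod 2) L (x ^ 2 ^ j) = Algebra.trace (ZMod 2) L x := by
  induction j with
  | zero => simp
  | succ j ih =>
    rw [pow_succ, pow_mul, ← ih]
    have := Algebra.trace_eq_of_algEquiv
      (FiniteField.frobeniusAlgEquivOfAlgebraic (ZMod 2) L) (x ^ 2 ^ j)
    simpa using this

/-- Nondegeneracy of the trace form. -/
theorem eq_zero_of_forall_trace_mul_eq_zero {y : L}
    (h : ∀ x : L, Algebra.trace (ZMod 2) L (x * y) = 0) : y = 0 := by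
  have : FiniteDimensional (ZMod 2) L := Module.Finite.of_finite
  refine (traceForm_nondegenerate (ZMod 2) L).2 y fun x => ?_
  simpa [Algebra.traceForm_apply] using h x

end Trace

section PrimitiveElement

variable {L : Type*} [Field L] [Fintype L] {t : L}

/-- The order of a primitive element. -/
theorem orderOf_primitive (ht : ∀ y : L, y ≠ 0 → ∃ j : ℕ, y = t ^ j) (ht0 : t ≠ 0) :
    orderOf t = Fintype.card L - 1 := by
  classical
  rw [← Fintype.card_units, ← Nat.card_eq_fintype_card]
  have : orderOf (Units.mk0 t ht0) = Nat.card Lˣ := by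
    refine orderOf_eq_card_of_forall_mem_zpowers fun y => ?_
    obtain ⟨j, hj⟩ := ht y y.ne_zero
    exact ⟨j, Units.ext (by simp [hj])⟩
  rw [← this, ← orderOf_units, Units.val_mk0]

/-- Equal powers of a primitive element of `GF(16^k)` have exponents congruent modulo `15`. -/
theorem modEq_of_primitive_pow_eq {k : ℕ} (hcard : Fintype.card L = 2 ^ (4 * k))
    (ht : ∀ y : L, y ≠ 0 → ∃ j : ℕ, y = t ^ j) (ht0 : t ≠ 0) {a b : ℕ} (h : t ^ a = t ^ b) :
    a ≡ b [MOD 15] := by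
  have hmod : a ≡ b [MOD orderOf t] := by
    have := pow_eq_pow_iff_modEq (x := Units.mk0 t ht0) (m := b) (n := a)
    rw [← orderOf_units, Units.val_mk0] at this
    exact this.1 (Units.ext (by simpa using h))
  refine hmod.of_dvd ?_
  rw [orderOf_primitive ht ht0, hcard, pow_mul]
  simpa using Nat.sub_dvd_pow_sub_pow 16 1 k

/-- Powers of two modulo `5` depend only on the exponent modulo `4`. -/
theorem two_pow_mod_five (j : ℕ) : 2 ^ j % 5 = 2 ^ (j % 4) % 5 := by
  conv_lhs => rw [← Nat.div_add_mod j 4, pow_add, pow_mul, Nat.mul_mod, Nat.pow_mod]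
  simp

/-- Odd powers of two are `2` modulo `3`. -/
theorem two_pow_mod_three {j : ℕ} (hj : Odd j) : 2 ^ j % 3 = 2 := by
  obtain ⟨r, rfl⟩ := hj
  rw [pow_succ, pow_mul, Nat.mul_mod, Nat.pow_mod]
  simp

/-- The congruence modulo `5` separating the two sides of the degenerate case. -/
theorem exponent_ne_mod_five {k s i m : ℕ} (hk : Odd k) (hs : Odd s) (hi : i = 1 ∨ i = 3)
    (hisk : i % 4 = (s * k) % 4) (hm : m = 4 - i) (j : ℕ) :
    ¬ (j + (2 ^ k - 1)) * 2 ^ (i * k) * 2 ^ s + j ≡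
      (j + (2 ^ k - 1)) * 2 ^ (m * k) + j * 2 ^ s [MOD 5] := by
  obtain ⟨e, he⟩ : ∃ e, 2 ^ k = e + 1 := ⟨2 ^ k - 1, (Nat.sub_add_cancel Nat.one_le_two_pow).symm⟩
  have hk4 : k % 4 = 1 ∨ k % 4 = 3 := by
    have := Nat.odd_iff.1 hk
    lia
  have hs4 : s % 4 = 1 ∨ s % 4 = 3 := by
    have := Nat.odd_iff.1 hs
    lia
  have h1 := two_pow_mod_five k
  have h2 := two_pow_mod_five s
  have h3 := two_pow_mod_five (i * k)
  have h4 := two_pow_mod_five (m * k)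
  rw [Nat.mul_mod] at h3 h4 hisk
  rw [he] at h1
  rw [he, Nat.add_sub_cancel]
  generalize 2 ^ s = S at *
  generalize 2 ^ (i * k) = I at *
  generalize 2 ^ (m * k) = M at *
  have hj : j % 5 < 5 := Nat.mod_lt _ (by norm_num)
  unfold Nat.ModEq
  rcases hk4 with hk4 | hk4 <;> rcases hs4 with hs4 | hs4 <;> rcases hi with rfl | rfl <;>
    subst hm <;> simp [hk4, hs4] at h1 h2 h3 h4 hisk
  all_goals
    have h1' : e % 5 = 1 ∨ e % 5 = 2 := by lia
    rcases h1' with h1' | h1' <;> try lia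
    all_goals
      interval_cases hj' : j % 5 <;> simp [Nat.add_mod, Nat.mul_mod, h1', h2, h3, h4, hj']

end PrimitiveElement

section Frobenius

/-- Fixed points of two iterates of the Frobenius are fixed by the iterate at the gcd. -/
theorem pow_two_pow_eq_self_of_gcd {L : Type*} [Monoid L] {a b d : ℕ} {x : L} (hd : Nat.gcd a b = d)
    (ha : x ^ 2 ^ a = x) (hb : x ^ 2 ^ b = x) : x ^ 2 ^ d = x := by
  have h : ∀ j, Function.IsPeriodicPt (fun y : L => y ^ 2) j x ↔ x ^ 2 ^ j = x := by
    intro j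
    rw [Function.IsPeriodicPt, Function.IsFixedPt, pow_iterate]
  rw [← h] at *
  exact hd ▸ ha.gcd hb

variable {L : Type*} [Field L] [Fintype L] [CharP L 2] {k s : ℕ}

/-- The determinant of the semilinear system is not the inverse of a `(2 ^ s + 1)`-st power. -/
theorem det_mul_ne_one (hk : Odd k) (hs : Odd s) (hcard : Fintype.card L = 2 ^ (4 * k))
    {t : L} (ht : ∀ y : L, y ≠ 0 → ∃ j : ℕ, y = t ^ j) (ht0 : t ≠ 0) {b α : L}
    (hα : α = t ^ (2 ^ k - 1)) (w : L) :
    (b * b ^ 2 ^ (2 * k) - (b * α) ^ 2 ^ k * (b * α) ^ 2 ^ (3 * k)) * (w * w ^ 2 ^ s) ≠ 1 := by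
  intro h
  have hφ : ∀ (x : L) (a b : ℕ), (x ^ 2 ^ a) ^ 2 ^ b = x ^ 2 ^ (a + b) := fun x a b => by
    rw [← pow_mul, ← pow_add]
  have hid : ∀ x : L, x ^ 2 ^ (4 * k) = x := fun x => by
    rw [← hcard]
    exact FiniteField.pow_card x
  have hαt : α = t ^ 2 ^ k / t := by
    rw [hα, eq_div_iff ht0, ← pow_succ, Nat.sub_add_cancel Nat.one_le_two_pow]
  set p := b * b ^ 2 ^ (2 * k) / (t * t ^ 2 ^ (2 * k)) with hp
  have hDz : b * b ^ 2 ^ (2 * k) - (b * α) ^ 2 ^ k * (b * α) ^ 2 ^ (3 * k) =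
      t * t ^ 2 ^ (2 * k) * (p + p ^ 2 ^ k) := by
    rw [CharTwo.sub_eq_add, hp, hαt]
    simp only [mul_pow, div_pow, hφ]
    rw [show k + k = 2 * k by ring, show 2 * k + k = 3 * k by ring,
      show k + 3 * k = 4 * k by ring, hid]
    have := pow_ne_zero (2 ^ k) ht0
    have := pow_ne_zero (2 ^ (2 * k)) ht0
    have := pow_ne_zero (2 ^ (3 * k)) ht0
    field_simp
  have hz : (p + p ^ 2 ^ k) ^ 2 ^ k = p + p ^ 2 ^ k := by
    rw [add_pow_char_pow, hφ, add_comm, show k + k = 2 * k by ring]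
    congr 1
    rw [hp]
    simp only [mul_pow, div_pow, hφ]
    rw [show 2 * k + 2 * k = 4 * k by ring, hid, hid, mul_comm b, mul_comm t]
  rw [hDz] at h
  generalize p + p ^ 2 ^ k = z at h hz
  have hz0 : z ≠ 0 := by
    rintro rfl
    simp at h
  have hw0 : w ≠ 0 := by
    rintro rfl
    simp at h
  obtain ⟨l, rfl⟩ := ht z hz0
  obtain ⟨j, rfl⟩ := ht w hw0
  have e₁ : t ^ (l * 2 ^ k) = t ^ l := by rw [pow_mul, hz]
  have e₂ : t ^ (1 + 2 ^ (2 * k) + l + (j + j * 2 ^ s)) = t ^ 0 := by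
    rw [pow_zero, ← h]
    ring
  have m₁ := (modEq_of_primitive_pow_eq hcard ht ht0 e₁).of_dvd (show 3 ∣ 15 by norm_num)
  have m₂ := (modEq_of_primitive_pow_eq hcard ht ht0 e₂).of_dvd (show 3 ∣ 15 by norm_num)
  have hk3 := two_pow_mod_three hk
  have hs3 := two_pow_mod_three hs
  have hkk : 2 ^ (2 * k) % 3 = 1 := by
    rw [pow_mul, Nat.pow_mod]
    simp
  unfold Nat.ModEq at m₁ m₂
  have m₁' : l * 2 % 3 = l % 3 := by rw [← m₁, Nat.mul_mod l (2 ^ k), hk3, Nat.mul_mod]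
  have m₃ : j * 2 ^ s % 3 = j * 2 % 3 := by rw [Nat.mul_mod, hs3, Nat.mul_mod j 2]
  lia

end Frobenius

/-- Let `f(x) = x^{2^s+1} + α x^{2^{ik} + 2^{mk+s}}` be the binomial of Family (2) on
`L = GF(2^{4k})`, `n = 4k`.  Then the nonlinearity of `f` satisfies
`NL(f) ≥ 2^{n-1} - 2^{n/2}`; equivalently, `|f^W(a,b)| ≤ 2^{(n+2)/2}` for all
`a ∈ L` and `b ∈ L^*`. -/
theorem stmt19 (k s : ℕ) (hk : 3 ≤ k) (hkodd : Odd k)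
    (hs : 0 < s) (hgcd : Nat.gcd s (2 * k) = 1)
    (i m : ℕ) (hi : i = 1 ∨ i = 3) (hisk : i % 4 = (s * k) % 4) (hm : m = 4 - i)
    (L : Type*) [Field L] [Fintype L] [Algebra (ZMod 2) L]
    (hcard : Fintype.card L = 2 ^ (4 * k))
    (t : L) (ht : ∀ y : L, y ≠ 0 → ∃ j : ℕ, y = t ^ j)
    (α : L) (hα : α = t ^ (2 ^ k - 1))
    (f : L → L) (hf : ∀ x, f x = x ^ (2 ^ s + 1) + α * x ^ (2 ^ (i * k) + 2 ^ (m * k + s))) :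
    ∀ a b : L, b ≠ 0 →
      |∑ x : L, (-1 : ℤ) ^ (Algebra.trace (ZMod 2) L (a * x + b * f x)).val| ≤
        2 ^ ((4 * k + 2) / 2) := by
  intro a b hb
  have : CharP L 2 := charP_of_injective_algebraMap (algebraMap (ZMod 2) L).injective 2
  have hsodd : Odd s := by
    have : Nat.Coprime s 2 := Nat.Coprime.coprime_mul_right_right hgcd
    exact Nat.coprime_two_right.1 this
  have hgcd4 : Nat.gcd s (4 * k) = 1 := by
    rw [show 4 * k = 2 * (2 * k) by ring]
    exact Nat.Coprime.mul_right (Nat.coprime_two_right.2 hsodd) hgcd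
  have hgcd2 : Nat.gcd (s + s) (4 * k) = 2 := by
    rw [show 4 * k = 2 * (2 * k) by ring, show s + s = 2 * s by ring, Nat.gcd_mul_left, hgcd]
  have hid : ∀ x : L, x ^ 2 ^ (4 * k) = x := fun x => by
    rw [← hcard]
    exact FiniteField.pow_card x
  have ht0 : t ≠ 0 := by
    rintro rfl
    classical
    have hsub : (Finset.univ : Finset L) ⊆ {0, 1} := by
      intro y _
      by_cases hy : y = 0
      · simp [hy]
      · obtain ⟨j, rfl⟩ := ht y hy
        rcases Nat.eq_zero_or_pos j with rfl | hj
        · simp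
        · exact absurd (zero_pow hj.ne') hy
    have h2 := (Finset.card_le_card hsub).trans Finset.card_le_two
    rw [Finset.card_univ, hcard] at h2
    have : 2 ^ 2 ≤ 2 ^ (4 * k) := Nat.pow_le_pow_right (by norm_num) (by lia)
    lia
  set Tr := Algebra.trace (ZMod 2) L
  set σ := iterateFrobenius L 2 s with hσ
  set c := iterateFrobenius L 2 (2 * k) with hc
  set R := iterateFrobenius L 2 (i * k) with hR
  set R' := iterateFrobenius L 2 (m * k) with hR'
  have hφ : ∀ (x : L) (a b : ℕ), (x ^ 2 ^ a) ^ 2 ^ b = x ^ 2 ^ (a + b) := fun x a b => by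
    rw [← pow_mul, ← pow_add]
  have hRR' : ∀ x, R (R' x) = x := by
    intro x
    simp only [hR, hR', iterateFrobenius_def, hφ]
    rcases hi with rfl | rfl <;> subst hm <;> rw [← add_mul, hid]
  have hR'R : ∀ x, R' (R x) = x := by
    intro x
    simp only [hR, hR', iterateFrobenius_def, hφ]
    rcases hi with rfl | rfl <;> subst hm <;> rw [← add_mul, hid]
  have hcc : ∀ x, R (R x) = c x := by
    intro x
    simp only [hR, hc, iterateFrobenius_def, hφ]
    rcases hi with rfl | rfl
    · ring_nf
    · rw [show 3 * k + 3 * k = 4 * k + 2 * k by ring, ← hφ, hid]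
  have hcc' : ∀ x, R' (R' x) = c x := by
    intro x
    simp only [hR', hc, iterateFrobenius_def, hφ]
    rcases hi with rfl | rfl <;> subst hm
    · rw [show (4 - 1) * k + (4 - 1) * k = 4 * k + 2 * k by ring, ← hφ, hid]
    · ring_nf
  have hcomm : ∀ x, R' (σ x) = σ (R' x) := by
    intro x
    simp only [hR', hσ, iterateFrobenius_def, hφ, add_comm]
  have hcommc : ∀ x, c (σ x) = σ (c x) := by
    intro x
    simp only [hc, hσ, iterateFrobenius_def, hφ, add_comm]
  have hc2 : ∀ x, c (c x) = x := by
    intro x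
    rw [← hcc', ← hcc, hR'R, hR'R]
  have hσσ : ∀ x, σ (σ x) = x ^ 2 ^ (s + s) := fun x => by
    simp only [hσ, iterateFrobenius_def, hφ]
  have hcA : c (R' (b * α)) = R (b * α) := by rw [← hcc, hRR']
  have hTσ : ∀ x, Tr (σ x) = Tr x := fun x => trace_pow_two_pow s x
  have hTR : ∀ x, Tr (R x) = Tr x := fun x => trace_pow_two_pow (i * k) x
  have hTR' : ∀ x, Tr (R' x) = Tr x := fun x => trace_pow_two_pow (m * k) x
  have hf' : ∀ x, f x = x * σ x + α * (R x * R' (σ x)) := by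
    intro x
    rw [hf, hcomm]
    simp only [hσ, hR, hR', iterateFrobenius_def, hφ]
    ring
  set A := R' (b * α) with hA
  set B : L → L → ZMod 2 := fun x u =>
    Tr (b * (σ x * u + x * σ u + α * (R x * R' (σ u) + R' (σ x) * R u))) with hB
  have hBeq : ∀ x u, B x u =
      Tr (σ x * ((σ b * σ (σ u) + σ A * σ (σ (c u))) + (b * u + c A * c u))) := by
    intro x u
    have e₁ : Tr (b * (x * σ u)) = Tr (σ x * (σ b * σ (σ u))) := by
      rw [← hTσ]
      simp only [map_mul]
      ring_nf
    have e₂ : Tr (b * α * (R x * R' (σ u))) = Tr (σ x * (σ A * σ (σ (c u)))) := by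
      rw [← hTR', ← hTσ, map_mul R' (b * α) (R x * _), map_mul R' (R x), hR'R, hcc', hcommc,
        ← hA, map_mul σ A, map_mul σ x]
      ring_nf
    have e₃ : Tr (b * α * (R' (σ x) * R u)) = Tr (σ x * (c A * c u)) := by
      rw [← hTR, map_mul R (b * α) (R' (σ x) * _), map_mul R (R' (σ x)), hRR', hcc, hcA]
      ring_nf
    simp only [hB]
    rw [show b * (σ x * u + x * σ u + α * (R x * R' (σ u) + R' (σ x) * R u)) =
      σ x * (b * u) + b * (x * σ u) + b * α * (R x * R' (σ u)) + b * α * (R' (σ x) * R u) by ring,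
      map_add, map_add, map_add, e₁, e₂, e₃, ← map_add, ← map_add, ← map_add]
    ring_nf
  have hsurj : Function.Surjective σ := Finite.surjective_of_injective σ.injective
  have hcard4 : ∀ K : Finset L, (∀ u ∈ K, ∀ x, B x u = 0) → K.card ≤ 4 := by
    intro K hK
    have h₁ : ∀ u ∈ K, σ b * σ (σ u) + σ A * σ (σ (c u)) = b * u + c A * c u := by
      intro u hu
      refine CharTwo.add_eq_zero.1 (eq_zero_of_forall_trace_mul_eq_zero fun y => ?_)
      obtain ⟨x, rfl⟩ := hsurj y
      rw [← hK u hu x, hBeq]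
    refine card_le_four σ c (b := b) (A := A) ?_ ?_ ?_ ?_ K h₁ ?_
    · intro h
      obtain ⟨j, rfl⟩ := ht b hb
      rw [hcA, hA, hα, ← pow_add] at h
      simp only [hR, hR', hσ, iterateFrobenius_def, ← pow_mul, ← pow_add] at h
      exact exponent_ne_mod_five hkodd hsodd hi hisk hm j
        ((modEq_of_primitive_pow_eq hcard ht ht0 h).of_dvd (by norm_num))
    · intro z hz hz0
      have := pow_two_pow_eq_self_of_gcd hgcd4 hz (hid z)
      rw [pow_one, sq] at this
      exact mul_left_cancel₀ hz0 (by rw [this, mul_one])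
    · intro z hz
      rw [hσσ] at hz
      exact pow_two_pow_eq_self_of_gcd hgcd2 hz (hid z)
    · intro w _
      have hAA : A * c A = (b * α) ^ 2 ^ k * (b * α) ^ 2 ^ (3 * k) := by
        rw [hcA, hA]
        simp only [hR, hR', iterateFrobenius_def]
        rcases hi with rfl | rfl <;> subst hm
        · rw [one_mul, mul_comm]
        · norm_num
      rw [hAA]
      exact det_mul_ne_one hkodd hsodd hcard ht ht0 hα w
    · intro u hu
      have := congrArg c (h₁ u hu)
      simp only [map_add, map_mul, hcommc, hc2] at this
      rw [add_comm (σ (c A) * _), add_comm (A * u)]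
      exact this
  have main := sq_sum_sign_le (fun x => Tr (a * x + b * f x)) B (fun x u => ?_) (fun x y u => ?_)
    4 hcard4
  · refine abs_le_of_sq_le_sq (main.trans_eq ?_) (by positivity)
    rw [hcard, show (4 * k + 2) / 2 = 2 * k + 1 by lia]
    push_cast
    ring
  · simp only [hB]
    rw [← map_add, ← map_add]
    congr 1
    simp only [hf', map_add]
    ring
  · simp only [hB]
    rw [← map_add]
    congr 1
    simp only [map_add]
    ring
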